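/- Let G be a group, μ a probability measure on G, and let 𝓜 be a finite, nonempty set of normalised minimal positive μ-harmonic functions that is invariant under the normalised translation action L_g(h) := (g.h)/(g.h)(e), where (g.h)(x) = h(g⁻¹x), for all g ∈ G. Then there exists a finite-index normal subgroup H ⊴ G and, for each h ∈ 𝓜, a group homomorphism χ_h : H → (0,∞) such that h(γ⁻¹x) = χ_h(γ) h(x) for all γ ∈ H and all x ∈ G. -/

import Mathlib

open Filter Topology

noncomputable section

/- Convolution powers of a measure `μ` on a group: `convPow μ 0 = δ_e`,
`convPow μ (n+1) x = ∑_g convPow μ n g * μ (g⁻¹ x)`. -/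
open Classical in
def convPow {G : Type*} [Group G] (μ : G → ℝ) : ℕ → G → ℝ
  | 0 => fun x => if x = 1 then 1 else 0
  | n + 1 => fun x => ∑' g : G, convPow μ n g * μ (g⁻¹ * x)

/-- The Green function `G(x,y) = ∑_{n≥0} μ^{(n)}(x⁻¹ y)`. -/
def green {G : Type*} [Group G] (μ : G → ℝ) (x y : G) : ℝ :=
  ∑' n : ℕ, convPow μ n (x⁻¹ * y)

/-- `μ` is a probability measure on `G`. -/
def IsProbMeasure {G : Type*} (μ : G → ℝ) : Prop :=
  (∀ g, 0 ≤ μ g) ∧ HasSum μ 1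

/-- `μ` is symmetric: `μ(g) = μ(g⁻¹)`. -/
def IsSymmetricMeasure {G : Type*} [Group G] (μ : G → ℝ) : Prop :=
  ∀ g : G, μ g = μ g⁻¹

/-- `μ` is non-degenerate: its support generates `G` as a semigroup. -/
def IsNonDegenerate {G : Type*} [Group G] (μ : G → ℝ) : Prop :=
  Subsemigroup.closure {g : G | μ g ≠ 0} = ⊤

/-- Transience: the Green function is finite, i.e. the series converges. -/
def IsTransient {G : Type*} [Group G] (μ : G → ℝ) : Prop :=
  ∀ x y : G, Summable fun n : ℕ => convPow μ n (x⁻¹ * y)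

/-- `f` is `μ`-harmonic: for every `k`, `∑_g μ(g) f(kg)` converges (absolutely,
since in `ℝ` summability is absolute) to `f k`. -/
def IsHarmonic {G : Type*} [Group G] (μ : G → ℝ) (f : G → ℝ) : Prop :=
  ∀ k : G, HasSum (fun g : G => μ g * f (k * g)) (f k)

/-- Word length of `x` with respect to a generating set `S`. -/
def wordLength {G : Type*} [Group G] (S : Set G) (x : G) : ℕ :=
  sInf {n : ℕ | ∃ l : List G, l.length = n ∧ (∀ a ∈ l, a ∈ S) ∧ l.prod = x}

/-- Outer boundary of `F` with respect to the generating set `T`: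
`∂F = {x ∉ F : ∃ y ∈ F, t ∈ T, x = y t}`. -/
def outerBoundary {G : Type*} [Group G] (T : Set G) (F : Set G) : Set G :=
  {x : G | x ∉ F ∧ ∃ y ∈ F, ∃ t ∈ T, x = y * t}

/-- The Green-variation functional
`Δ(F;a,b) = max_{x ∈ ∂F} |G(a,x) − G(b,x)| / G(a,x)`. -/
def greenDelta {G : Type*} [Group G] (μ : G → ℝ) (T : Set G) (F : Set G) (a b : G) : ℝ :=
  sSup ((fun x => |green μ a x - green μ b x| / green μ a x) '' outerBoundary T F)

/-- `h` is a minimal positive `μ`-harmonic function. -/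
def IsMinimalHarmonic {G : Type*} [Group G] (μ : G → ℝ) (h : G → ℝ) : Prop :=
  (∀ x, 0 < h x) ∧ IsHarmonic μ h ∧
    ∀ u : G → ℝ, (∀ x, 0 < u x) → IsHarmonic μ u → (∀ x, u x ≤ h x) →
      ∃ c > (0:ℝ), ∀ x, u x = c * h x
/-- The normalised translation action `(g • h) x = h (g⁻¹ x) / h g⁻¹` of `G` on an invariant set
of positive normalised functions. -/
abbrev normalisedTranslationAction {G : Type*} [Group G] (𝓜 : Set (G → ℝ))
    (hpos : ∀ h ∈ 𝓜, ∀ x, 0 < h x) (hone : ∀ h ∈ 𝓜, h 1 = 1)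
    (hinv : ∀ g : G, ∀ h ∈ 𝓜, (fun x => h (g⁻¹ * x) / h g⁻¹) ∈ 𝓜) : MulAction G 𝓜 where
  smul g h := ⟨fun x => h.1 (g⁻¹ * x) / h.1 g⁻¹, hinv g h.1 h.2⟩
  one_smul h := by
    apply Subtype.ext
    funext x
    change h.1 (1⁻¹ * x) / h.1 1⁻¹ = h.1 x
    simp [hone h.1 h.2]
  mul_smul g k h := by
    apply Subtype.ext
    funext x
    change h.1 ((g * k)⁻¹ * x) / h.1 (g * k)⁻¹ =
      (h.1 (k⁻¹ * (g⁻¹ * x)) / h.1 k⁻¹) / (h.1 (k⁻¹ * g⁻¹) / h.1 k⁻¹)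
    rw [div_div_div_cancel_right₀ (hpos h.1 h.2 _).ne', mul_inv_rev, mul_assoc]

/-- (Finite orbit ⇒ eigencharacter on a finite-index subgroup.)
If a finite nonempty set `𝓜` of normalised minimal positive `μ`-harmonic functions
is invariant under the normalised translation action, then there is a finite-index
normal subgroup `H ⊴ G` and, for each `h ∈ 𝓜`, a homomorphism `χ_h : H → (0,∞)`
with `h(γ⁻¹ x) = χ_h(γ) h(x)` for all `γ ∈ H`, `x ∈ G`. -/
theorem finite_orbit_eigencharacter
    {G : Type*} [Group G] (μ : G → ℝ) (hprob : IsProbMeasure μ)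
    (𝓜 : Set (G → ℝ)) (hfin : 𝓜.Finite) (hne : 𝓜.Nonempty)
    (hmem : ∀ h ∈ 𝓜, IsMinimalHarmonic μ h ∧ h 1 = 1)
    (hinv : ∀ g : G, ∀ h ∈ 𝓜, (fun x => h (g⁻¹ * x) / h g⁻¹) ∈ 𝓜) :
    ∃ H : Subgroup G, H.Normal ∧ H.FiniteIndex ∧
      ∀ h ∈ 𝓜, ∃ χ : G → ℝ,
        (∀ γ ∈ H, 0 < χ γ) ∧
        (∀ γ₁ ∈ H, ∀ γ₂ ∈ H, χ (γ₁ * γ₂) = χ γ₁ * χ γ₂) ∧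
        (∀ γ ∈ H, ∀ x : G, h (γ⁻¹ * x) = χ γ * h x) := by
  let _ : MulAction G 𝓜 := normalisedTranslationAction 𝓜
    (fun h hh => (hmem h hh).1.1) (fun h hh => (hmem h hh).2) hinv
  have : Finite 𝓜 := hfin
  refine ⟨(MulAction.toPermHom G 𝓜).ker, inferInstance, inferInstance, fun h hh => ?_⟩
  have hpos := (hmem h hh).1.1
  have heig : ∀ γ ∈ (MulAction.toPermHom G 𝓜).ker, ∀ x, h (γ⁻¹ * x) = h γ⁻¹ * h x := by
    intro γ hγ x
    have hfix : γ • (⟨h, hh⟩ : 𝓜) = ⟨h, hh⟩ := DFunLike.congr_fun (MonoidHom.mem_ker.1 hγ) _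
    have hx : h (γ⁻¹ * x) / h γ⁻¹ = h x := congrFun (congrArg Subtype.val hfix) x
    rw [← hx, mul_div_cancel₀ _ (hpos _).ne']
  refine ⟨fun γ => h γ⁻¹, fun γ _ => hpos _, fun γ₁ _ γ₂ h₂ => ?_, heig⟩
  simp only [mul_inv_rev]
  rw [heig γ₂ h₂, mul_comm]
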